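/- Theorem 1.1(a)/Theorem 4.1 (first part). Fix an integer k ≥ 2 (not depending on n) and let ω(n) be any function tending to infinity as n → ∞. Then asymptotically almost surely, n·ln k/(ω(n)·k) ≤ ξ(K_n, k) ≤ ω(n)·n·ln k/k; that is, the probability that the broadcasting time ξ(K_n,k) lies between n ln k/(ω(n) k) and ω(n) n ln k/k tends to 1 as n → ∞. -/

import Mathlib

open Finset Filter

/-- Positions: `p t a` is the vertex (an element of `Fin n`) occupied by agent `a` at the end of
round `t`. `greenSet n k p t` is the set of green agents at the end of round `t`; the initially
green agent is the agent with index `0`, and a white agent becomes green as soon as it occupies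
the same vertex as a green agent. -/
def greenSet (n k : ℕ) (p : ℕ → Fin k → Fin n) : ℕ → Finset (Fin k)
  | 0 => Finset.univ.filter fun a => ∃ b : Fin k, (b : ℕ) = 0 ∧ p 0 a = p 0 b
  | t + 1 =>
      greenSet n k p t ∪
        Finset.univ.filter fun a => ∃ b ∈ greenSet n k p t, p (t + 1) a = p (t + 1) b

/-- The probability that the `k` agents follow the trajectory prefix `p` during rounds
`0, 1, …, T`: each agent starts at a uniformly random vertex of `K_n` and then moves, each round
and independently of everything else, to a uniformly random vertex distinct from its current
one. -/
noncomputable def prefixProb (n k T : ℕ) (p : Fin (T + 1) → Fin k → Fin n) : ℝ :=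
  ∏ a : Fin k, ((n : ℝ)⁻¹ *
    ∏ t : Fin T, if p t.succ a = p t.castSucc a then 0 else ((n : ℝ) - 1)⁻¹)

/-- `probXiLe n k T` is `P(ξ(K_n, k) ≤ T)`: the probability that the broadcast is complete by
the end of round `T`. -/
noncomputable def probXiLe (n k T : ℕ) : ℝ :=
  ∑ p : Fin (T + 1) → Fin k → Fin n,
    if greenSet n k (fun t a => p ⟨min t T, Nat.lt_succ_of_le (min_le_right t T)⟩ a) T
        = Finset.univ
      then prefixProb n k T p else 0

/-- `probXiEq n k t` is `P(ξ(K_n, k) = t)`. -/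
noncomputable def probXiEq (n k : ℕ) : ℕ → ℝ
  | 0 => probXiLe n k 0
  | t + 1 => probXiLe n k (t + 1) - probXiLe n k t

/-- `probXiMem n k S` is `P(ξ(K_n, k) ∈ S)`: the probability that the broadcasting time of the
process with `k` agents on `K_n` belongs to the set `S ⊆ ℕ`. -/
noncomputable def probXiMem (n k : ℕ) (S : Set ℕ) : ℝ :=
  ∑' t, S.indicator (probXiEq n k) t

/-- `expXi n k = E[ξ(K_n, k)] = ∑_{t ≥ 0} P(ξ(K_n, k) > t)`. -/
noncomputable def expXi (n k : ℕ) : ℝ :=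
  ∑' t, (1 - probXiLe n k t)

/-- One-step transition probability of a single agent on `K_n`. -/
noncomputable def stepProb (n : ℕ) (u v : Fin n) : ℝ :=
  if v = u then 0 else ((n : ℝ) - 1)⁻¹

/-- The infinite trajectory that follows `p` up to round `T` and then stays put. -/
def clampPath {n k T : ℕ} (p : Fin (T + 1) → Fin k → Fin n) : ℕ → Fin k → Fin n :=
  fun t a => p ⟨min t T, Nat.lt_succ_of_le (min_le_right t T)⟩ a

/-- The expectation of `F` over the trajectory prefixes of length `T`. -/
noncomputable def prefixExp (n k T : ℕ) (F : (Fin (T + 1) → Fin k → Fin n) → ℝ) : ℝ :=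
  ∑ p, prefixProb n k T p * F p

/-- The expectation of `F` over product measures with weights `w`. -/
noncomputable def prodExp {n k : ℕ} (w : Fin k → Fin n → ℝ) (F : (Fin k → Fin n) → ℝ) : ℝ :=
  ∑ x : Fin k → Fin n, (∏ a, w a (x a)) * F x

section ProductWeights

variable {n k : ℕ} {w : Fin k → Fin n → ℝ}

lemma prodExp_one (hw : ∀ a, ∑ v, w a v = 1) : prodExp w (fun _ => 1) = 1 := by
  simp only [prodExp, mul_one]
  rw [← Fintype.piFinset_univ, ← Finset.prod_univ_sum]
  simp [hw]

lemma prodExp_mono (hw : ∀ a v, 0 ≤ w a v) {F G : (Fin k → Fin n) → ℝ} (h : ∀ x, F x ≤ G x) :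
    prodExp w F ≤ prodExp w G :=
  Finset.sum_le_sum fun x _ =>
    mul_le_mul_of_nonneg_left (h x) (Finset.prod_nonneg fun a _ => hw a _)

lemma prodExp_eq_ite (hw : ∀ a, ∑ v, w a v = 1) {a b : Fin k} (hab : a ≠ b) :
    prodExp w (fun x => if x a = x b then 1 else 0) = ∑ v, w a v * w b v := by
  have key : ∀ v : Fin n, ∑ x : Fin k → Fin n,
      ∏ c, (w c (x c) * if (c = a ∨ c = b) ∧ x c ≠ v then 0 else 1) = w a v * w b v := by
    intro v
    rw [← Fintype.piFinset_univ, ← Finset.prod_univ_sum (fun _ => Finset.univ)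
      (fun c y => w c y * if (c = a ∨ c = b) ∧ y ≠ v then 0 else 1)]
    rw [Finset.prod_eq_mul a b hab]
    · simp
    · intro c _ hc
      simp [hc.1, hc.2, hw]
    · simp
    · simp
  rw [← Finset.sum_congr rfl fun v _ => key v, Finset.sum_comm, prodExp]
  refine Finset.sum_congr rfl fun x _ => ?_
  simp_rw [Finset.prod_mul_distrib]
  rw [← Finset.mul_sum]
  congr 1
  have h : ∀ v : Fin n, (∏ c, if (c = a ∨ c = b) ∧ x c ≠ v then (0 : ℝ) else 1)
      = if x a = v ∧ x b = v then 1 else 0 := by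
    intro v
    split_ifs with hv
    · refine Finset.prod_eq_one fun c _ => if_neg ?_
      rintro ⟨rfl | rfl, h⟩
      · exact h hv.1
      · exact h hv.2
    · rw [not_and_or] at hv
      rcases hv with hv | hv
      · exact Finset.prod_eq_zero (Finset.mem_univ a) (if_pos ⟨Or.inl rfl, hv⟩)
      · exact Finset.prod_eq_zero (Finset.mem_univ b) (if_pos ⟨Or.inr rfl, hv⟩)
  simp_rw [h]
  by_cases hx : x a = x b
  · simp [hx]
  · rw [if_neg hx]
    refine (Finset.sum_eq_zero fun v _ => if_neg ?_).symm
    rintro ⟨h1, h2⟩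
    exact hx (h1.trans h2.symm)

end ProductWeights

lemma stepProb_nonneg {n : ℕ} (hn : 2 ≤ n) (u v : Fin n) : 0 ≤ stepProb n u v := by
  have : (2 : ℝ) ≤ n := by exact_mod_cast hn
  unfold stepProb
  split_ifs
  · exact le_rfl
  · exact inv_nonneg.2 (by linarith)

lemma sum_stepProb {n : ℕ} (hn : 2 ≤ n) (u : Fin n) : ∑ v, stepProb n u v = 1 := by
  have : (2 : ℝ) ≤ n := by exact_mod_cast hn
  have h : ∀ v, stepProb n u v = ((n : ℝ) - 1)⁻¹ - if v = u then ((n : ℝ) - 1)⁻¹ else 0 := by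
    intro v
    unfold stepProb
    split_ifs <;> simp
  simp_rw [h]
  have h1 : (n : ℝ) - 1 ≠ 0 := by linarith
  simp
  field_simp

lemma sum_stepProb_mul_le {n : ℕ} (hn : 2 ≤ n) (u u' : Fin n) :
    ∑ v, stepProb n u v * stepProb n u' v ≤ ((n : ℝ) - 1)⁻¹ := by
  have h2 : (2 : ℝ) ≤ n := by exact_mod_cast hn
  calc ∑ v, stepProb n u v * stepProb n u' v
      ≤ ∑ v, stepProb n u v * ((n : ℝ) - 1)⁻¹ := by
        refine Finset.sum_le_sum fun v _ =>
          mul_le_mul_of_nonneg_left ?_ (stepProb_nonneg hn u v)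
        unfold stepProb
        split_ifs
        · exact inv_nonneg.2 (by linarith)
        · exact le_rfl
    _ = ((n : ℝ) - 1)⁻¹ := by rw [← Finset.sum_mul, sum_stepProb hn, one_mul]

lemma sum_stepProb_mul_of_ne {n : ℕ} (hn : 2 ≤ n) {u u' : Fin n} (huu' : u ≠ u') :
    ∑ v, stepProb n u v * stepProb n u' v = ((n : ℝ) - 2) / ((n : ℝ) - 1) ^ 2 := by
  have h2 : (2 : ℝ) ≤ n := by exact_mod_cast hn
  have h1 : (n : ℝ) - 1 ≠ 0 := by linarith
  have h : ∀ v, stepProb n u v * stepProb n u' v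
      = (stepProb n u v - if v = u' then ((n : ℝ) - 1)⁻¹ else 0) * ((n : ℝ) - 1)⁻¹ := by
    intro v
    unfold stepProb
    by_cases h : v = u'
    · subst h
      simp [huu'.symm]
    · simp [h]
  simp_rw [h]
  rw [← Finset.sum_mul, Finset.sum_sub_distrib, sum_stepProb hn]
  simp only [Finset.sum_ite_eq', Finset.mem_univ, if_true]
  field_simp
  ring

lemma prefixProb_nonneg {n : ℕ} (hn : 2 ≤ n) (k T : ℕ) (p : Fin (T + 1) → Fin k → Fin n) :
    0 ≤ prefixProb n k T p :=
  Finset.prod_nonneg fun a _ => mul_nonneg (by positivity)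
    (Finset.prod_nonneg fun t _ => stepProb_nonneg hn (p t.castSucc a) (p t.succ a))

lemma prefixProb_snoc (n k T : ℕ) (p : Fin (T + 1) → Fin k → Fin n) (x : Fin k → Fin n) :
    prefixProb n k (T + 1) (Fin.snoc (α := fun _ => Fin k → Fin n) p x) =
      prefixProb n k T p * ∏ a, stepProb n (p (Fin.last T) a) (x a) := by
  unfold prefixProb
  rw [← Finset.prod_mul_distrib]
  refine Finset.prod_congr rfl fun a _ => ?_
  rw [Fin.prod_univ_castSucc, mul_assoc]
  congr 1
  congr 1
  · refine Finset.prod_congr rfl fun t _ => ?_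
    rw [Fin.succ_castSucc, Fin.snoc_castSucc, Fin.snoc_castSucc]
  · rw [Fin.succ_last, Fin.snoc_last, Fin.snoc_castSucc]
    rfl

lemma prefixExp_succ (n k T : ℕ) (F : (Fin (T + 2) → Fin k → Fin n) → ℝ) :
    prefixExp n k (T + 1) F = prefixExp n k T fun p =>
      prodExp (fun a => stepProb n (p (Fin.last T) a))
        fun x => F (Fin.snoc (α := fun _ => Fin k → Fin n) p x) := by
  unfold prefixExp prodExp
  rw [← (Fin.snocEquiv fun _ => Fin k → Fin n).sum_comp, Fintype.sum_prod_type_right]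
  refine Finset.sum_congr rfl fun p _ => ?_
  rw [Finset.mul_sum]
  refine Finset.sum_congr rfl fun x _ => ?_
  rw [← mul_assoc, ← prefixProb_snoc]
  rfl

lemma prefixExp_zero (n k : ℕ) (F : (Fin 1 → Fin k → Fin n) → ℝ) :
    prefixExp n k 0 F = prodExp (fun _ _ => (n : ℝ)⁻¹) fun x => F fun _ => x := by
  unfold prefixExp prodExp
  rw [← (Equiv.funUnique (Fin 1) (Fin k → Fin n)).symm.sum_comp]
  refine Finset.sum_congr rfl fun x _ => ?_
  have h : (Equiv.funUnique (Fin 1) (Fin k → Fin n)).symm x = fun _ => x := rfl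
  simp only [h, prefixProb, Finset.univ_eq_empty, Finset.prod_empty, mul_one]

lemma prefixExp_mono {n : ℕ} (hn : 2 ≤ n) {k T : ℕ} {F G : (Fin (T + 1) → Fin k → Fin n) → ℝ}
    (h : ∀ p, F p ≤ G p) : prefixExp n k T F ≤ prefixExp n k T G :=
  Finset.sum_le_sum fun p _ => mul_le_mul_of_nonneg_left (h p) (prefixProb_nonneg hn k T p)

lemma sum_uniform {n : ℕ} (hn : 2 ≤ n) : ∑ _v : Fin n, (n : ℝ)⁻¹ = 1 := by
  have : (n : ℝ) ≠ 0 := by positivity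
  simp [this]

lemma prefixExp_one {n : ℕ} (hn : 2 ≤ n) (k T : ℕ) : prefixExp n k T (fun _ => 1) = 1 := by
  induction T with
  | zero => rw [prefixExp_zero, prodExp_one fun _ => sum_uniform hn]
  | succ T ih =>
    rw [prefixExp_succ]
    simp_rw [prodExp_one fun a => sum_stepProb hn _]
    exact ih

lemma greenSet_congr {n k : ℕ} {p q : ℕ → Fin k → Fin n} (T : ℕ) (h : ∀ t ≤ T, p t = q t) :
    greenSet n k p T = greenSet n k q T := by
  induction T with
  | zero => simp [greenSet, h 0 le_rfl]
  | succ T ih => simp only [greenSet, ih fun t ht => h t (by omega), h (T + 1) le_rfl]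

lemma clampPath_snoc_of_le {n k T t : ℕ} (p : Fin (T + 1) → Fin k → Fin n) (x : Fin k → Fin n)
    (ht : t ≤ T) :
    clampPath (Fin.snoc (α := fun _ => Fin k → Fin n) p x) t = clampPath p t := by
  funext a
  have h : (⟨min t (T + 1), Nat.lt_succ_of_le (min_le_right t (T + 1))⟩ : Fin (T + 2)) =
      Fin.castSucc ⟨min t T, Nat.lt_succ_of_le (min_le_right t T)⟩ := by
    ext
    simp
    omega
  unfold clampPath
  rw [h, Fin.snoc_castSucc]

lemma clampPath_snoc_succ {n k T : ℕ} (p : Fin (T + 1) → Fin k → Fin n) (x : Fin k → Fin n) :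
    clampPath (Fin.snoc (α := fun _ => Fin k → Fin n) p x) (T + 1) = x := by
  funext a
  have h : (⟨min (T + 1) (T + 1), Nat.lt_succ_of_le (min_le_right _ _)⟩ : Fin (T + 2)) =
      Fin.last (T + 1) := by
    ext
    simp
  unfold clampPath
  rw [h, Fin.snoc_last]

lemma clampPath_self {n k T : ℕ} (p : Fin (T + 1) → Fin k → Fin n) :
    clampPath p T = p (Fin.last T) := by
  funext a
  have h : (⟨min T T, Nat.lt_succ_of_le (min_le_right T T)⟩ : Fin (T + 1)) = Fin.last T := by
    ext
    simp
  unfold clampPath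
  rw [h]

/-- The set of agents that are green after following the prefix `p`. -/
def finalGreen {n k T : ℕ} (p : Fin (T + 1) → Fin k → Fin n) : Finset (Fin k) :=
  greenSet n k (clampPath p) T

lemma mem_finalGreen_snoc {n k T : ℕ} (p : Fin (T + 1) → Fin k → Fin n) (x : Fin k → Fin n)
    (c : Fin k) :
    c ∈ finalGreen (Fin.snoc (α := fun _ => Fin k → Fin n) p x) ↔
      c ∈ finalGreen p ∨ ∃ b ∈ finalGreen p, x c = x b := by
  unfold finalGreen
  simp only [greenSet, clampPath_snoc_succ,
    greenSet_congr T fun t ht => clampPath_snoc_of_le p x ht, Finset.mem_union,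
    Finset.mem_filter, Finset.mem_univ, true_and]

lemma mem_finalGreen_zero {n k : ℕ} (x : Fin k → Fin n) {z : Fin k} (hz : (z : ℕ) = 0)
    (c : Fin k) : c ∈ finalGreen (T := 0) (fun _ => x) ↔ x c = x z := by
  simp only [finalGreen, greenSet, Finset.mem_filter, Finset.mem_univ, true_and]
  constructor
  · rintro ⟨b, hb, h⟩
    have : b = z := Fin.ext (hb.trans hz.symm)
    subst this
    exact h
  · exact fun h => ⟨z, hz, h⟩

lemma mem_greenSet_source {n k : ℕ} (p : ℕ → Fin k → Fin n) {z : Fin k} (hz : (z : ℕ) = 0)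
    (T : ℕ) : z ∈ greenSet n k p T := by
  induction T with
  | zero => simpa [greenSet] using ⟨z, hz, rfl⟩
  | succ T ih => exact Finset.mem_union_left _ ih

lemma mem_greenSet_of_eq_source {n k : ℕ} (p : ℕ → Fin k → Fin n) {z c : Fin k}
    (hz : (z : ℕ) = 0) (T : ℕ) (h : p T c = p T z) : c ∈ greenSet n k p T := by
  cases T with
  | zero => simpa [greenSet] using ⟨z, hz, h⟩
  | succ T =>
    refine Finset.mem_union_right _ ?_
    simpa using ⟨z, mem_greenSet_source p hz T, h⟩

lemma prefixExp_not_mem_le {n : ℕ} (hn : 2 ≤ n) {k : ℕ} {z c : Fin k} (hz : (z : ℕ) = 0)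
    (hc : c ≠ z) (T : ℕ) :
    prefixExp n k T (fun p => if c ∈ finalGreen p then 0 else 1) ≤
      (1 - ((n : ℝ) - 2) / ((n : ℝ) - 1) ^ 2) ^ T := by
  induction T with
  | zero =>
    rw [pow_zero]
    refine le_of_le_of_eq (prefixExp_mono hn fun p => ?_) (prefixExp_one hn k 0)
    split_ifs <;> norm_num
  | succ T ih =>
    set r : ℝ := 1 - ((n : ℝ) - 2) / ((n : ℝ) - 1) ^ 2 with hr
    have hn' : (2 : ℝ) ≤ n := by exact_mod_cast hn
    have hr0 : 0 ≤ r := by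
      rw [hr, sub_nonneg, div_le_one (by nlinarith)]
      nlinarith
    rw [prefixExp_succ]
    calc _ ≤ prefixExp n k T (fun p => (if c ∈ finalGreen p then 0 else 1) * r) := by
          refine prefixExp_mono hn fun p => ?_
          by_cases hp : c ∈ finalGreen p
          · simp [mem_finalGreen_snoc, hp, prodExp]
          · have hne : p (Fin.last T) c ≠ p (Fin.last T) z := by
              intro h
              refine hp (mem_greenSet_of_eq_source _ hz T ?_)
              rwa [clampPath_self]
            rw [if_neg hp, one_mul, hr, ← sum_stepProb_mul_of_ne hn hne,
              ← prodExp_eq_ite (w := fun a => stepProb n (p (Fin.last T) a))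
                (fun a => sum_stepProb hn _) hc]
            refine le_of_le_of_eq ?_ (congrArg (· - _)
              (prodExp_one (w := fun a => stepProb n (p (Fin.last T) a))
                (fun a => sum_stepProb hn _)))
            unfold prodExp
            simp only
            rw [← Finset.sum_sub_distrib]
            simp_rw [← mul_sub]
            refine prodExp_mono (fun a v => stepProb_nonneg hn _ v) fun x => ?_
            by_cases hx : x c = x z
            · rw [if_pos hx, if_pos ((mem_finalGreen_snoc p x c).2
                (Or.inr ⟨z, mem_greenSet_source _ hz T, hx⟩))]
              norm_num
            · rw [if_neg hx]
              split_ifs <;> norm_num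
      _ = prefixExp n k T (fun p => if c ∈ finalGreen p then 0 else 1) * r := by
          unfold prefixExp
          rw [Finset.sum_mul]
          simp_rw [mul_assoc]
      _ ≤ r ^ T * r := mul_le_mul_of_nonneg_right ih hr0
      _ = r ^ (T + 1) := (pow_succ r T).symm

lemma prefixExp_mem_le {n : ℕ} (hn : 2 ≤ n) {k : ℕ} {z c : Fin k} (hz : (z : ℕ) = 0)
    (hc : c ≠ z) (T : ℕ) :
    prefixExp n k T (fun p => if c ∈ finalGreen p then 1 else 0) ≤
      (T + 1) * (k * ((n : ℝ) - 1)⁻¹) := by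
  have hn' : (2 : ℝ) ≤ n := by exact_mod_cast hn
  have hi : 0 < ((n : ℝ) - 1)⁻¹ := inv_pos.2 (by linarith)
  have hk : (1 : ℝ) ≤ k := by exact_mod_cast (Nat.zero_le _).trans_lt c.2
  induction T with
  | zero =>
    rw [prefixExp_zero]
    simp_rw [mem_finalGreen_zero _ hz]
    rw [prodExp_eq_ite (fun _ => sum_uniform hn) hc, ← Finset.sum_mul, sum_uniform hn]
    have : (n : ℝ)⁻¹ ≤ ((n : ℝ) - 1)⁻¹ := inv_anti₀ (by linarith) (by linarith)
    push_cast
    nlinarith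
  | succ T ih =>
    rw [prefixExp_succ]
    calc _ ≤ prefixExp n k T
          (fun p => (if c ∈ finalGreen p then 1 else 0) + k * ((n : ℝ) - 1)⁻¹) := by
          refine prefixExp_mono hn fun p => ?_
          have hw : ∀ a, ∑ v, stepProb n (p (Fin.last T) a) v = 1 := fun a => sum_stepProb hn _
          have hw0 : ∀ a v, 0 ≤ stepProb n (p (Fin.last T) a) v :=
            fun a v => stepProb_nonneg hn _ v
          by_cases hp : c ∈ finalGreen p
          · simp only [mem_finalGreen_snoc, hp, true_or, if_true]
            rw [prodExp_one hw]
            linarith [mul_nonneg (zero_le_one.trans hk) hi.le]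
          · rw [if_neg hp, zero_add]
            calc _ ≤ prodExp (fun a => stepProb n (p (Fin.last T) a))
                    (fun x => ∑ b ∈ Finset.univ.erase c, if x c = x b then 1 else 0) := by
                  refine prodExp_mono hw0 fun x => ?_
                  have h0 : ∀ b ∈ Finset.univ.erase c,
                      (0 : ℝ) ≤ if x c = x b then 1 else 0 := fun b _ => by
                    split_ifs <;> norm_num
                  split_ifs with hx
                  · rcases (mem_finalGreen_snoc p x c).1 hx with h | ⟨b, hb, h⟩
                    · exact absurd h hp
                    · have hbc : b ∈ Finset.univ.erase c :=
                        Finset.mem_erase.2 ⟨fun e => hp (e ▸ hb), Finset.mem_univ b⟩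
                      refine le_trans ?_ (Finset.single_le_sum h0 hbc)
                      rw [if_pos h]
                  · exact Finset.sum_nonneg h0
              _ = ∑ b ∈ Finset.univ.erase c,
                    prodExp (fun a => stepProb n (p (Fin.last T) a))
                      (fun x => if x c = x b then 1 else 0) := by
                  unfold prodExp
                  simp_rw [Finset.mul_sum]
                  exact Finset.sum_comm
              _ ≤ ∑ b ∈ Finset.univ.erase c, ((n : ℝ) - 1)⁻¹ := by
                  refine Finset.sum_le_sum fun b hb => ?_
                  rw [prodExp_eq_ite hw (Finset.ne_of_mem_erase hb).symm]
                  exact sum_stepProb_mul_le hn _ _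
              _ ≤ ∑ b : Fin k, ((n : ℝ) - 1)⁻¹ :=
                  Finset.sum_le_sum_of_subset_of_nonneg (Finset.erase_subset _ _)
                    fun _ _ _ => hi.le
              _ = k * ((n : ℝ) - 1)⁻¹ := by simp
      _ = prefixExp n k T (fun p => if c ∈ finalGreen p then 1 else 0)
            + k * ((n : ℝ) - 1)⁻¹ := by
          have h1 := prefixExp_one hn k T
          unfold prefixExp at h1 ⊢
          simp only [mul_one] at h1
          simp_rw [mul_add]
          rw [Finset.sum_add_distrib, ← Finset.sum_mul, h1, one_mul]
      _ ≤ (T + 1) * (k * ((n : ℝ) - 1)⁻¹) + k * ((n : ℝ) - 1)⁻¹ := by linarith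
      _ = _ := by
          push_cast
          ring

lemma probXiLe_eq_prefixExp (n k T : ℕ) :
    probXiLe n k T = prefixExp n k T fun p => if finalGreen p = Finset.univ then 1 else 0 := by
  unfold probXiLe prefixExp
  refine Finset.sum_congr rfl fun p _ => ?_
  rw [mul_ite, mul_one, mul_zero]
  rfl

lemma probXiLe_nonneg {n : ℕ} (hn : 2 ≤ n) (k T : ℕ) : 0 ≤ probXiLe n k T := by
  rw [probXiLe_eq_prefixExp]
  refine Finset.sum_nonneg fun p _ => mul_nonneg (prefixProb_nonneg hn k T p) ?_
  dsimp only
  split_ifs <;> norm_num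

lemma probXiLe_le_one {n : ℕ} (hn : 2 ≤ n) (k T : ℕ) : probXiLe n k T ≤ 1 := by
  rw [probXiLe_eq_prefixExp]
  refine le_of_le_of_eq (prefixExp_mono hn fun p => ?_) (prefixExp_one hn k T)
  split_ifs <;> norm_num

lemma probXiLe_le {n k : ℕ} (hn : 2 ≤ n) (hk : 2 ≤ k) (T : ℕ) :
    probXiLe n k T ≤ (T + 1) * (k * ((n : ℝ) - 1)⁻¹) := by
  rw [probXiLe_eq_prefixExp]
  refine le_trans (prefixExp_mono hn fun p => ?_)
    (prefixExp_mem_le hn (z := ⟨0, by omega⟩) (c := ⟨1, by omega⟩) rfl (by simp) T)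
  by_cases hp : finalGreen p = Finset.univ
  · simp [hp]
  · rw [if_neg hp]
    split_ifs <;> norm_num

lemma one_sub_le_probXiLe {n k : ℕ} (hn : 2 ≤ n) (hk : 2 ≤ k) (T : ℕ) :
    1 - k * (1 - ((n : ℝ) - 2) / ((n : ℝ) - 1) ^ 2) ^ T ≤ probXiLe n k T := by
  obtain ⟨z, hz⟩ : ∃ z : Fin k, (z : ℕ) = 0 := ⟨⟨0, by omega⟩, rfl⟩
  have hn' : (2 : ℝ) ≤ n := by exact_mod_cast hn
  have hr0 : 0 ≤ 1 - ((n : ℝ) - 2) / ((n : ℝ) - 1) ^ 2 := by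
    rw [sub_nonneg, div_le_one (by nlinarith)]
    nlinarith
  have h1 : ∀ c : Fin k, prefixExp n k T (fun p => if c ∈ finalGreen p then 0 else 1) ≤
      (1 - ((n : ℝ) - 2) / ((n : ℝ) - 1) ^ 2) ^ T := by
    intro c
    by_cases hc : c = z
    · have : ∀ p : Fin (T + 1) → Fin k → Fin n, c ∈ finalGreen p :=
        fun p => hc ▸ mem_greenSet_source _ hz T
      simp only [this, if_true, prefixExp, mul_zero, Finset.sum_const_zero]
      positivity
    · exact prefixExp_not_mem_le hn hz hc T
  have h2 : 1 ≤ probXiLe n k T +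
      ∑ c : Fin k, prefixExp n k T (fun p => if c ∈ finalGreen p then 0 else 1) := by
    rw [probXiLe_eq_prefixExp]
    refine (prefixExp_one hn k T).symm.trans_le ?_
    unfold prefixExp
    rw [Finset.sum_comm, ← Finset.sum_add_distrib]
    refine Finset.sum_le_sum fun p _ => ?_
    rw [← Finset.mul_sum, ← mul_add]
    refine mul_le_mul_of_nonneg_left ?_ (prefixProb_nonneg hn k T p)
    dsimp only
    have h0 : ∀ c ∈ (Finset.univ : Finset (Fin k)),
        (0 : ℝ) ≤ if c ∈ finalGreen p then 0 else 1 := fun c _ => by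
      split_ifs <;> norm_num
    split_ifs with hp
    · linarith [Finset.sum_nonneg h0]
    · rw [Finset.eq_univ_iff_forall] at hp
      push Not at hp
      obtain ⟨c, hc⟩ := hp
      have := Finset.single_le_sum h0 (Finset.mem_univ c)
      rw [if_neg hc] at this
      linarith
  have h3 := Finset.sum_le_sum fun c (_ : c ∈ (Finset.univ : Finset (Fin k))) => h1 c
  rw [Finset.sum_const, Finset.card_univ, Fintype.card_fin, nsmul_eq_mul] at h3
  linarith

lemma sum_probXiEq_Icc (n k : ℕ) {A B : ℕ} (h : A ≤ B) :
    ∑ t ∈ Finset.Icc (A + 1) B, probXiEq n k t = probXiLe n k B - probXiLe n k A := by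
  induction B, h using Nat.le_induction with
  | base => simp
  | succ B hAB ih =>
    rw [Finset.sum_Icc_succ_top (by omega), ih, probXiEq]
    ring

lemma probXiMem_Icc_eq (n k : ℕ) {a b : ℝ} (ha : 0 < a) (hab : a ≤ b) :
    probXiMem n k {t | a ≤ (t : ℝ) ∧ (t : ℝ) ≤ b} =
      probXiLe n k ⌊b⌋₊ - probXiLe n k (⌈a⌉₊ - 1) := by
  have hpos : 0 < ⌈a⌉₊ := Nat.ceil_pos.2 ha
  have hle : ⌈a⌉₊ - 1 ≤ ⌊b⌋₊ := by
    have h1 := Nat.ceil_le_floor_add_one a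
    have h2 := Nat.floor_le_floor hab
    omega
  rw [← sum_probXiEq_Icc n k hle, Nat.sub_add_cancel hpos, probXiMem]
  have hmem : ∀ t : ℕ, t ∈ {t : ℕ | a ≤ (t : ℝ) ∧ (t : ℝ) ≤ b} ↔
      t ∈ Finset.Icc ⌈a⌉₊ ⌊b⌋₊ := by
    intro t
    rw [Set.mem_ofPred_eq, Finset.mem_Icc, Nat.ceil_le, Nat.le_floor_iff (ha.le.trans hab)]
  rw [tsum_eq_sum (s := Finset.Icc ⌈a⌉₊ ⌊b⌋₊)]
  · exact Finset.sum_congr rfl fun t ht => Set.indicator_of_mem ((hmem t).2 ht) _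
  · exact fun t ht => Set.indicator_of_notMem (fun h => ht ((hmem t).1 h)) _

lemma tendsto_probXiLe_zero {k : ℕ} (hk : 2 ≤ k) {a : ℕ → ℝ} (ha : ∀ᶠ n in atTop, 0 < a n)
    (hlim : Tendsto (fun n => a n / n) atTop (nhds 0)) :
    Tendsto (fun n => probXiLe n k (⌈a n⌉₊ - 1)) atTop (nhds 0) := by
  have hinv : Tendsto (fun n : ℕ => (1 : ℝ) / n) atTop (nhds 0) :=
    tendsto_one_div_atTop_nhds_zero_nat
  have hb : Tendsto (fun n : ℕ => 2 * k * (a n / n + 1 / n)) atTop (nhds 0) := by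
    simpa using (hlim.add hinv).const_mul (2 * (k : ℝ))
  refine tendsto_of_tendsto_of_tendsto_of_le_of_le' tendsto_const_nhds hb ?_ ?_
  · filter_upwards [eventually_ge_atTop 2] with n hn using probXiLe_nonneg hn k _
  · filter_upwards [eventually_ge_atTop 2, ha] with n hn han
    have hn' : (2 : ℝ) ≤ n := by exact_mod_cast hn
    have hpos : 1 ≤ ⌈a n⌉₊ := Nat.ceil_pos.2 han
    have hc : (⌈a n⌉₊ : ℝ) ≤ a n + 1 := (Nat.ceil_lt_add_one han.le).le
    have hi : ((n : ℝ) - 1)⁻¹ ≤ 2 / n := by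
      rw [inv_eq_one_div, div_le_div_iff₀ (by linarith) (by linarith)]
      linarith
    have hi0 : 0 ≤ ((n : ℝ) - 1)⁻¹ := inv_nonneg.2 (by linarith)
    calc _ ≤ _ := probXiLe_le hn hk _
      _ = ⌈a n⌉₊ * (k * ((n : ℝ) - 1)⁻¹) := by
          rw [Nat.cast_sub hpos]
          push_cast
          ring
      _ ≤ (a n + 1) * (k * (2 / n)) := by gcongr
      _ = _ := by ring

lemma tendsto_probXiLe_one {k : ℕ} (hk : 2 ≤ k) {b : ℕ → ℝ}
    (hlim : Tendsto (fun n => b n / n) atTop atTop) :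
    Tendsto (fun n => probXiLe n k ⌊b n⌋₊) atTop (nhds 1) := by
  have hexp : Tendsto (fun n => 1 - k * Real.exp (-((b n / n) / 2 - 1))) atTop (nhds 1) := by
    have h1 : Tendsto (fun n => b n / n / 2 - 1) atTop atTop :=
      tendsto_atTop_add_const_right _ (-1) (hlim.atTop_div_const two_pos)
    have h2 := (Real.tendsto_exp_neg_atTop_nhds_zero.comp h1).const_mul (k : ℝ)
    simpa using h2.const_sub 1
  refine tendsto_of_tendsto_of_tendsto_of_le_of_le' hexp tendsto_const_nhds ?_ ?_
  · filter_upwards [eventually_ge_atTop 3] with n hn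
    have hn' : (3 : ℝ) ≤ n := by exact_mod_cast hn
    refine le_trans ?_ (one_sub_le_probXiLe (by omega) hk _)
    set s : ℝ := ((n : ℝ) - 2) / ((n : ℝ) - 1) ^ 2 with hs
    have hs1 : s ≤ 1 := by
      rw [hs, div_le_one (by nlinarith)]
      nlinarith
    have hs2 : 1 / (2 * n) ≤ s := by
      rw [hs, div_le_div_iff₀ (by linarith) (by nlinarith)]
      nlinarith
    have hf : b n - 1 ≤ ⌊b n⌋₊ := (Nat.sub_one_lt_floor (b n)).le
    have hpow : (1 - s) ^ ⌊b n⌋₊ ≤ Real.exp (-((b n / n) / 2 - 1)) := by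
      calc (1 - s) ^ ⌊b n⌋₊ ≤ Real.exp (-s) ^ ⌊b n⌋₊ :=
            pow_le_pow_left₀ (by linarith) (Real.one_sub_le_exp_neg s) _
        _ = Real.exp (-(⌊b n⌋₊ * s)) := by rw [← Real.exp_nat_mul, mul_neg]
        _ ≤ _ := by
            refine Real.exp_le_exp.2 (neg_le_neg ?_)
            calc b n / n / 2 - 1 ≤ (b n - 1) * (1 / (2 * n)) := by
                  have h1 : 1 / (2 * (n : ℝ)) ≤ 1 := by
                    rw [div_le_one (by linarith)]
                    linarith
                  have h2 : (b n - 1) * (1 / (2 * n)) = b n / n / 2 - 1 / (2 * n) := by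
                    field_simp
                  linarith
              _ ≤ ⌊b n⌋₊ * (1 / (2 * n)) := by gcongr
              _ ≤ ⌊b n⌋₊ * s := by gcongr
    gcongr
  · filter_upwards [eventually_ge_atTop 2] with n hn using probXiLe_le_one hn k _

/-- **Theorem 1.1(a) / Theorem 4.1 (first part).**  Fix an integer `k ≥ 2` and let `ω` be any
function tending to infinity.  Then a.a.s.
`n·ln k/(ω(n)·k) ≤ ξ(K_n, k) ≤ ω(n)·n·ln k/k`. -/
theorem broadcasting_time_constant_k
    (k : ℕ) (hk : 2 ≤ k) (ω : ℕ → ℝ) (hω : Tendsto ω atTop atTop) :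
    Tendsto (fun n =>
        probXiMem n k {t | (n : ℝ) * Real.log k / (ω n * k) ≤ (t : ℝ) ∧
          (t : ℝ) ≤ ω n * n * Real.log k / k})
      atTop (nhds 1) := by
  have hk' : (2 : ℝ) ≤ k := by exact_mod_cast hk
  have hlog : 0 < Real.log k := Real.log_pos (by linarith)
  have hc : 0 < Real.log k / k := by positivity
  have hne : ∀ᶠ n : ℕ in atTop, (n : ℝ) ≠ 0 := by
    filter_upwards [eventually_ge_atTop 1] with n hn
    positivity
  have hlow : Tendsto (fun n : ℕ => (n : ℝ) * Real.log k / (ω n * k) / n) atTop (nhds 0) := by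
    refine (hω.const_div_atTop (Real.log k / k)).congr' ?_
    filter_upwards [hne, hω.eventually_gt_atTop 0] with n hn hωn
    field_simp
  have hup : Tendsto (fun n : ℕ => ω n * n * Real.log k / k / n) atTop atTop := by
    refine (hω.atTop_mul_const hc).congr' ?_
    filter_upwards [hne] with n hn
    field_simp
  have hpos : ∀ᶠ n : ℕ in atTop, 0 < (n : ℝ) * Real.log k / (ω n * k) := by
    filter_upwards [eventually_ge_atTop 1, hω.eventually_gt_atTop 0] with n hn hωn
    positivity
  have hdiff := (tendsto_probXiLe_one hk hup).sub (tendsto_probXiLe_zero hk hpos hlow)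
  rw [sub_zero] at hdiff
  refine hdiff.congr' ?_
  filter_upwards [hpos, hω.eventually_ge_atTop 1] with n hn hωn
  refine (probXiMem_Icc_eq n k hn ?_).symm
  rw [div_le_div_iff₀ (by positivity) (by linarith)]
  have : 1 ≤ ω n * ω n := by nlinarith
  have h0 : 0 ≤ (n : ℝ) * Real.log k * k := by positivity
  nlinarith
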